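/- Many upsets hold simultaneously (Lemma 3.4): For every p_0 ∈ (0,1], every positive integer N and every ε > 0 there exists δ = δ(p_0, N, ε) > 0 such that the following holds. Let P be a finite poset with a least element x_0, let μ be a probability measure on P with μ(x_0) ≥ p_0, and let n, m ≥ 1. If A_1, …, A_m are upsets in P^n with μ^n(A_i) ≤ 1 − ε for every i and μ^n(A_1 ∪ ⋯ ∪ A_m) ≥ 1 − δ, then μ^n({ω ∈ P^n : at least N of the indices i satisfy ω ∈ A_i}) ≥ 1 − ε. -/

import Mathlib

/-- The mass that the `n`-fold power of the weight `μ` gives to `S`. -/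
noncomputable def powerMass {P : Type*} [Fintype P] (μ : P → ℝ) (n : ℕ)
    (S : Set (Fin n → P)) : ℝ :=
  ∑ x : Fin n → P, S.indicator (fun y => ∏ j, μ (y j)) x

section PowerMass

variable {P : Type*} [Fintype P] {μ : P → ℝ} {n : ℕ}

theorem powerMass_nonneg (hμ : ∀ x, 0 ≤ μ x) (S : Set (Fin n → P)) :
    0 ≤ powerMass μ n S :=
  Finset.sum_nonneg fun _ _ =>
    Set.indicator_nonneg (fun _ _ => Finset.prod_nonneg fun _ _ => hμ _) _

theorem powerMass_mono (hμ : ∀ x, 0 ≤ μ x) {S T : Set (Fin n → P)} (h : S ⊆ T) :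
    powerMass μ n S ≤ powerMass μ n T :=
  Finset.sum_le_sum fun x _ =>
    Set.indicator_le_indicator_of_subset h (fun _ => Finset.prod_nonneg fun _ _ => hμ _) x

theorem powerMass_union_le (hμ : ∀ x, 0 ≤ μ x) (S T : Set (Fin n → P)) :
    powerMass μ n (S ∪ T) ≤ powerMass μ n S + powerMass μ n T := by
  classical
  unfold powerMass
  rw [← Finset.sum_add_distrib]
  refine Finset.sum_le_sum fun x _ => ?_
  have h : 0 ≤ ∏ j, μ (x j) := Finset.prod_nonneg fun _ _ => hμ _
  by_cases hS : x ∈ S <;> by_cases hT : x ∈ T <;> simp [hS, hT, h]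

theorem powerMass_univ (hsum : ∑ x, μ x = 1) : powerMass μ n Set.univ = 1 := by
  classical
  have h := Finset.prod_univ_sum (fun _ : Fin n => (Finset.univ : Finset P)) (fun _ x => μ x)
  simp only [hsum, Finset.prod_const_one, Fintype.piFinset_univ] at h
  simp [powerMass, ← h]

theorem powerMass_empty : powerMass μ n ∅ = 0 := by simp [powerMass]

theorem powerMass_compl (hsum : ∑ x, μ x = 1) (S : Set (Fin n → P)) :
    powerMass μ n Sᶜ = 1 - powerMass μ n S := by
  rw [← powerMass_univ (n := n) hsum, eq_sub_iff_add_eq]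
  unfold powerMass
  rw [← Finset.sum_add_distrib]
  refine Finset.sum_congr rfl fun x _ => ?_
  rw [Set.indicator_univ]
  exact Set.indicator_compl_add_self_apply S _ x

theorem powerMass_succ (S : Set (Fin (n + 1) → P)) :
    powerMass μ (n + 1) S
      = ∑ x, μ x * powerMass μ n {y | (Fin.cons x y : Fin (n + 1) → P) ∈ S} := by
  classical
  unfold powerMass
  rw [← (Fin.consEquiv fun _ : Fin (n + 1) => P).sum_comp, Fintype.sum_prod_type]
  refine Finset.sum_congr rfl fun x _ => ?_
  rw [Finset.mul_sum]
  refine Finset.sum_congr rfl fun y _ => ?_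
  simp [Set.indicator_apply, Fin.consEquiv, Fin.prod_univ_succ]

end PowerMass

/-- The tangent line inequality for `x ↦ x ^ k` on the nonnegative reals. -/
theorem pow_add_mul_sub_le_pow (k : ℕ) {s t : ℝ} (hs : 0 ≤ s) (ht : 0 ≤ t) :
    t ^ (k + 1) + (k + 1) * t ^ k * (s - t) ≤ s ^ (k + 1) := by
  induction k with
  | zero => simp
  | succ k ih =>
    have h1 := mul_le_mul_of_nonneg_left ih hs
    have h2 : 0 ≤ (k + 1) * t ^ k * (s - t) ^ 2 := by positivity
    push_cast
    calc _ = s * (t ^ (k + 1) + (k + 1) * t ^ k * (s - t))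
          - (k + 1) * t ^ k * (s - t) ^ 2 := by ring
      _ ≤ s * s ^ (k + 1) := by linarith
      _ = _ := by ring

theorem one_sub_pow_le_one_sub_half_mul_pow {q w : ℝ} {k : ℕ} (hq : 0 ≤ q) (hq1 : q ≤ 1)
    (hk : q * (2 * k + 1) ≤ 2 * k) (hw : 0 ≤ w) (hw1 : w ≤ 1) :
    (1 - w) ^ k ≤ (1 - q * w / 2) ^ (2 * k + 1) := by
  rcases Nat.eq_zero_or_pos k with rfl | hkpos
  · have : q = 0 := by simp at hk; linarith
    simp [this]
  have hk' : (0 : ℝ) < k := by exact_mod_cast hkpos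
  have hqw : q * w ≤ 1 := mul_le_one₀ hq1 hw hw1
  have h0 : 0 ≤ 1 - q * w / 2 := by linarith
  have hbern := one_add_mul_self_le_rpow_one_add (s := -(q * w / 2)) (p := (2 * k + 1) / k)
    (by linarith) (by rw [le_div_iff₀ hk']; linarith)
  rw [← sub_eq_add_neg, mul_neg, ← sub_eq_add_neg] at hbern
  have hle : 1 - w ≤ (1 - q * w / 2) ^ (((2 * k + 1) / k : ℝ)) := by
    refine le_trans ?_ hbern
    have : (2 * k + 1) / k * (q * w / 2) = (q * (2 * k + 1)) * w / (2 * k) := by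
      field_simp
    have h2 : (q * (2 * k + 1)) * w / (2 * k) ≤ w := by
      rw [div_le_iff₀ (by positivity)]
      nlinarith
    linarith
  calc (1 - w) ^ k ≤ ((1 - q * w / 2) ^ (((2 * k + 1) / k : ℝ))) ^ k :=
        pow_le_pow_left₀ (by linarith) hle k
    _ = (1 - q * w / 2) ^ (2 * k + 1) := by
        rw [← Real.rpow_natCast, ← Real.rpow_mul h0, div_mul_cancel₀ _ hk'.ne',
          ← Real.rpow_natCast]
        norm_num

theorem one_sub_half_mul_pow_le {q w : ℝ} {k : ℕ} (hq : 0 ≤ q) (hq1 : q ≤ 1)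
    (hk : q * (2 * k + 1) ≤ 2 * k) (hw : 0 ≤ w) (hw1 : w ≤ 1) :
    (1 - q * w / 2) ^ (2 * (k + 1)) ≤ 1 - q + q * (1 - w) ^ (k + 1) := by
  have hderiv : ∀ x : ℝ, HasDerivAt
      (fun w : ℝ => 1 - q + q * (1 - w) ^ (k + 1) - (1 - q * w / 2) ^ (2 * k + 1 + 1))
      (q * (k + 1) * ((1 - q * x / 2) ^ (2 * k + 1) - (1 - x) ^ k)) x := by
    intro x
    have h1 := (((hasDerivAt_id x).const_sub 1).pow (k + 1)).const_mul q
    have h2 := ((((hasDerivAt_id x).const_mul q).div_const 2).const_sub 1).pow (2 * k + 1 + 1)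
    refine ((h1.const_add (1 - q)).sub h2).congr_deriv ?_
    simp only [id, Nat.add_sub_cancel]
    push_cast
    ring
  have hmono : MonotoneOn
      (fun w : ℝ => 1 - q + q * (1 - w) ^ (k + 1) - (1 - q * w / 2) ^ (2 * k + 1 + 1))
      (Set.Icc 0 1) := by
    refine monotoneOn_of_deriv_nonneg (convex_Icc 0 1)
      (fun x _ => (hderiv x).continuousAt.continuousWithinAt)
      (fun x _ => (hderiv x).differentiableAt.differentiableWithinAt) fun x hx => ?_
    rw [interior_Icc] at hx
    rw [(hderiv x).deriv]
    exact mul_nonneg (by positivity)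
      (sub_nonneg.2 (one_sub_pow_le_one_sub_half_mul_pow hq hq1 hk hx.1.le hx.2.le))
  have h := hmono (Set.left_mem_Icc.2 zero_le_one) ⟨hw, hw1⟩ hw
  simp only [sub_zero, mul_zero, zero_div, one_pow, mul_one] at h
  rw [show 2 * (k + 1) = 2 * k + 1 + 1 by ring]
  linarith

section Correlation

variable {P : Type*} [Fintype P] {μ : P → ℝ} {x0 : P} {p0 : ℝ} {k : ℕ}

theorem sum_mul_sum_pow_le_of_le_one (hμ : ∀ x, 0 ≤ μ x)
    (hsum : ∑ x, μ x = 1) (hx0 : p0 ≤ μ x0) (hk : 1 ≤ p0 * (k + 1)) {a b : P → ℝ}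
    (ha : ∀ x, 0 ≤ a x) (hb : ∀ x, 0 ≤ b x) (ha1 : ∀ x, a x ≤ 1) (hb1 : ∀ x, b x ≤ 1)
    (ha0 : a x0 = 1) (hb0 : b x0 = 1) :
    ((∑ x, μ x * a x) * ∑ x, μ x * b x) ^ (k + 1) ≤ ∑ x, μ x * (a x * b x) ^ (k + 1) := by
  classical
  set s := (Finset.univ : Finset P).erase x0
  have hsplit : ∀ f : P → ℝ, ∑ x, f x = f x0 + ∑ x ∈ s, f x := fun f =>
    (Finset.add_sum_erase _ f (Finset.mem_univ x0)).symm
  set q := ∑ x ∈ s, μ x with hq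
  have hpq : μ x0 = 1 - q := by have := hsplit μ; linarith
  have hq0 : 0 ≤ q := Finset.sum_nonneg fun x _ => hμ x
  have hq1 : q ≤ 1 := by linarith [hμ x0]
  set α := ∑ x ∈ s, μ x * a x with hα
  set β := ∑ x ∈ s, μ x * b x with hβ
  have hα0 : 0 ≤ α := Finset.sum_nonneg fun x _ => mul_nonneg (hμ x) (ha x)
  have hβ0 : 0 ≤ β := Finset.sum_nonneg fun x _ => mul_nonneg (hμ x) (hb x)
  have hαq : α ≤ q := Finset.sum_le_sum fun x _ => mul_le_of_le_one_right (hμ x) (ha1 x)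
  have hβq : β ≤ q := Finset.sum_le_sum fun x _ => mul_le_of_le_one_right (hμ x) (hb1 x)
  obtain ⟨t, ht0, ht1, htq⟩ : ∃ t : ℝ, 0 ≤ t ∧ t ≤ 1 ∧ q * t = max (α + β - q) 0 := by
    rcases hq0.eq_or_lt with h | h
    · refine ⟨0, le_rfl, zero_le_one, ?_⟩
      rw [max_eq_right (by linarith)]; simp
    · refine ⟨max (α + β - q) 0 / q, by positivity, ?_, by field_simp⟩
      rw [div_le_one h]
      exact max_le (by linarith) hq0
  have hprod : q * t ≤ ∑ x ∈ s, μ x * (a x * b x) := by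
    rw [htq]
    refine max_le ?_ (Finset.sum_nonneg fun x _ => mul_nonneg (hμ x) (mul_nonneg (ha x) (hb x)))
    rw [hα, hβ, hq, ← Finset.sum_add_distrib, ← Finset.sum_sub_distrib]
    refine Finset.sum_le_sum fun x _ => ?_
    nlinarith [mul_nonneg (hμ x) (mul_nonneg (sub_nonneg.2 (ha1 x)) (sub_nonneg.2 (hb1 x)))]
  have hpow : q * t ^ (k + 1) ≤ ∑ x ∈ s, μ x * (a x * b x) ^ (k + 1) := by
    have h1 : ∑ x ∈ s, μ x * (t ^ (k + 1) + (k + 1) * t ^ k * (a x * b x - t))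
        ≤ ∑ x ∈ s, μ x * (a x * b x) ^ (k + 1) :=
      Finset.sum_le_sum fun x _ => mul_le_mul_of_nonneg_left
        (pow_add_mul_sub_le_pow k (mul_nonneg (ha x) (hb x)) ht0) (hμ x)
    have h2 : ∑ x ∈ s, μ x * (t ^ (k + 1) + (k + 1) * t ^ k * (a x * b x - t))
        = q * t ^ (k + 1)
          + (k + 1) * t ^ k * ((∑ x ∈ s, μ x * (a x * b x)) - q * t) := by
      rw [hq, mul_sub, Finset.sum_mul, Finset.sum_mul, Finset.mul_sum, Finset.mul_sum,
        ← Finset.sum_sub_distrib, ← Finset.sum_add_distrib]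
      exact Finset.sum_congr rfl fun x _ => by ring
    have h3 : 0 ≤ (k + 1) * t ^ k * ((∑ x ∈ s, μ x * (a x * b x)) - q * t) :=
      mul_nonneg (by positivity) (sub_nonneg.2 hprod)
    linarith
  have hkq : q * (2 * k + 1) ≤ 2 * k := by
    have : (p0 : ℝ) * (k + 1) ≤ (1 - q) * (k + 1) :=
      mul_le_mul_of_nonneg_right (by linarith) (by positivity)
    nlinarith
  have hkey := one_sub_half_mul_pow_le (w := 1 - t) hq0 hq1 hkq (by linarith) (by linarith)
  rw [sub_sub_cancel, pow_mul] at hkey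
  rw [hsplit, hsplit fun x => μ x * b x, hsplit fun x => μ x * (a x * b x) ^ (k + 1)]
  simp only [ha0, hb0, mul_one, one_pow, hpq]
  refine le_trans (pow_le_pow_left₀ (mul_nonneg (by linarith) (by linarith)) ?_ _)
    (hkey.trans (by linarith))
  have hle : α + β - q ≤ q * t := htq ▸ le_max_left _ _
  have hqt : q * (1 - t) ≤ 1 := mul_le_one₀ hq1 (by linarith) (by linarith)
  calc (1 - q + α) * (1 - q + β) ≤ ((1 - q + α + (1 - q + β)) / 2) ^ 2 := by
        nlinarith [sq_nonneg (α - β)]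
    _ ≤ (1 - q * (1 - t) / 2) ^ 2 := pow_le_pow_left₀ (by linarith) (by linarith) 2

theorem sum_mul_sum_pow_le (hμ : ∀ x, 0 ≤ μ x)
    (hsum : ∑ x, μ x = 1) (hx0 : p0 ≤ μ x0) (hk : 1 ≤ p0 * (k + 1)) {a b : P → ℝ}
    (ha : ∀ x, 0 ≤ a x) (hb : ∀ x, 0 ≤ b x) (ha1 : ∀ x, a x ≤ a x0) (hb1 : ∀ x, b x ≤ b x0) :
    ((∑ x, μ x * a x) * ∑ x, μ x * b x) ^ (k + 1) ≤ ∑ x, μ x * (a x * b x) ^ (k + 1) := by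
  rcases (ha x0).eq_or_lt with h | h
  · have : ∀ x, a x = 0 := fun x => le_antisymm (h ▸ ha1 x) (ha x)
    simp [this]
  rcases (hb x0).eq_or_lt with h' | h'
  · have : ∀ x, b x = 0 := fun x => le_antisymm (h' ▸ hb1 x) (hb x)
    simp [this]
  have key := sum_mul_sum_pow_le_of_le_one hμ hsum hx0 hk
    (a := fun x => a x / a x0) (b := fun x => b x / b x0)
    (fun x => div_nonneg (ha x) h.le) (fun x => div_nonneg (hb x) h'.le)
    (fun x => (div_le_one h).2 (ha1 x)) (fun x => (div_le_one h').2 (hb1 x))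
    (div_self h.ne') (div_self h'.ne')
  have hpos : 0 < (a x0 * b x0) ^ (k + 1) := by positivity
  have e1 : ∑ x, μ x * (a x / a x0 * (b x / b x0)) ^ (k + 1)
      = (∑ x, μ x * (a x * b x) ^ (k + 1)) / (a x0 * b x0) ^ (k + 1) := by
    rw [Finset.sum_div]
    exact Finset.sum_congr rfl fun x _ => by rw [div_mul_div_comm, div_pow, mul_div_assoc]
  simp only [← mul_div_assoc, ← Finset.sum_div] at key e1
  rw [e1, div_mul_eq_mul_div, div_div, div_pow] at key
  exact (div_le_div_iff_of_pos_right hpos).1 key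

/-- A substitute for the Harris inequality in powers of a poset with a least element. -/
theorem powerMass_mul_pow_le_inter [PartialOrder P] (hbot : ∀ x, x0 ≤ x) (hμ : ∀ x, 0 ≤ μ x)
    (hsum : ∑ x, μ x = 1) (hx0 : p0 ≤ μ x0) (hk : 1 ≤ p0 * (k + 1)) :
    ∀ (n : ℕ) {D E : Set (Fin n → P)}, IsLowerSet D → IsLowerSet E →
      (powerMass μ n D * powerMass μ n E) ^ (k + 1) ≤ powerMass μ n (D ∩ E) := by
  intro n
  induction n with
  | zero =>
    intro D E _ _
    classical
    simp only [powerMass, Finset.univ_unique, Finset.sum_singleton, Set.indicator_apply,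
      Set.mem_inter_iff]
    by_cases hD : (default : Fin 0 → P) ∈ D <;> by_cases hE : (default : Fin 0 → P) ∈ E <;>
      simp [hD, hE]
  | succ n ih =>
    intro D E hD hE
    have hsec : ∀ {S : Set (Fin (n + 1) → P)}, IsLowerSet S → ∀ x,
        IsLowerSet {y : Fin n → P | (Fin.cons x y : Fin (n + 1) → P) ∈ S} :=
      fun hS x y z hzy hy => hS (Fin.cons_le_cons.2 ⟨le_rfl, hzy⟩) hy
    have hle : ∀ {S : Set (Fin (n + 1) → P)}, IsLowerSet S → ∀ x,
        powerMass μ n {y | (Fin.cons x y : Fin (n + 1) → P) ∈ S}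
          ≤ powerMass μ n {y | (Fin.cons x0 y : Fin (n + 1) → P) ∈ S} :=
      fun hS x => powerMass_mono hμ fun y hy => hS (Fin.cons_le_cons.2 ⟨hbot x, le_rfl⟩) hy
    rw [powerMass_succ D, powerMass_succ E, powerMass_succ (D ∩ E)]
    refine (sum_mul_sum_pow_le hμ hsum hx0 hk (fun _ => powerMass_nonneg hμ _)
      (fun _ => powerMass_nonneg hμ _) (hle hD) (hle hE)).trans ?_
    exact Finset.sum_le_sum fun x _ =>
      mul_le_mul_of_nonneg_left (ih (hsec hD x) (hsec hE x)) (hμ x)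

end Correlation

theorem isLowerSet_forall_notMem {Q ι : Type*} [Preorder Q] {A : ι → Set Q}
    (hA : ∀ i, IsUpperSet (A i)) (J : Finset ι) : IsLowerSet {ω | ∀ i ∈ J, ω ∉ A i} :=
  fun _ _ hyx hx i hi hy => hx i hi (hA i hyx hy)

section Upsets

variable {P : Type*} [Fintype P] [PartialOrder P] {μ : P → ℝ} {x0 : P} {p0 : ℝ} {k n m : ℕ}
  {A : Fin m → Set (Fin n → P)} {ε t : ℝ}

theorem exists_subset_powerMass_forall_notMem (hbot : ∀ x, x0 ≤ x) (hμ : ∀ x, 0 ≤ μ x)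
    (hsum : ∑ x, μ x = 1) (hx0 : p0 ≤ μ x0) (hk : 1 ≤ p0 * (k + 1))
    (hA : ∀ i, IsUpperSet (A i)) (hAε : ∀ i, powerMass μ n (A i) ≤ 1 - ε)
    (hε : 0 ≤ ε) (ht : 0 ≤ t) (ht1 : t < 1) (J : Finset (Fin m))
    (hJ : powerMass μ n {ω | ∀ i ∈ J, ω ∉ A i} ≤ t) :
    ∃ I ⊆ J, powerMass μ n {ω | ∀ i ∈ I, ω ∉ A i} ≤ t ∧
      (ε * t) ^ (k + 1) ≤ powerMass μ n {ω | ∀ i ∈ I, ω ∉ A i} := by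
  classical
  induction J using Finset.induction_on with
  | empty =>
    have h1 : powerMass μ n Set.univ = 1 := powerMass_univ hsum
    simp only [Finset.notMem_empty, false_imp_iff, implies_true, Set.ofPred_true, h1] at hJ
    exact absurd hJ (not_le.2 ht1)
  | insert j J _ ih =>
    by_cases h : powerMass μ n {ω | ∀ i ∈ J, ω ∉ A i} ≤ t
    · obtain ⟨I, hI, h'⟩ := ih h
      exact ⟨I, hI.trans (Finset.subset_insert _ _), h'⟩
    · refine ⟨_, subset_rfl, hJ, ?_⟩
      have hc := powerMass_mul_pow_le_inter hbot hμ hsum hx0 hk n (hA j).compl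
        (isLowerSet_forall_notMem hA J)
      have hset : (A j)ᶜ ∩ {ω | ∀ i ∈ J, ω ∉ A i} = {ω | ∀ i ∈ insert j J, ω ∉ A i} := by
        ext ω; simp
      rw [hset, powerMass_compl hsum] at hc
      refine (pow_le_pow_left₀ (by positivity) ?_ _).trans hc
      have := hAε j
      exact mul_le_mul (by linarith) (not_le.1 h).le ht (by linarith)

end Upsets

theorem exists_forall_powerMass_card_lt_le {p0 ε t : ℝ} {k : ℕ} (hk : 1 ≤ p0 * (k + 1))
    (hε : 0 < ε) (ht : 0 < t) (ht1 : t < 1) (N : ℕ) :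
    ∃ δ : ℝ, 0 < δ ∧ ∀ (P : Type*) [Fintype P] [PartialOrder P] (x0 : P), (∀ x, x0 ≤ x) →
      ∀ μ : P → ℝ, (∀ x, 0 ≤ μ x) → ∑ x, μ x = 1 → p0 ≤ μ x0 →
      ∀ (n m : ℕ) (A : Fin m → Set (Fin n → P)), (∀ i, IsUpperSet (A i)) →
      (∀ i, powerMass μ n (A i) ≤ 1 - ε) → ∀ J : Finset (Fin m),
      powerMass μ n {ω | ∀ i ∈ J, ω ∉ A i} ≤ δ →
      powerMass μ n {ω | Set.ncard {i | i ∈ J ∧ ω ∈ A i} < N} ≤ N * t := by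
  induction N with
  | zero => exact ⟨1, one_pos, by intros; simp [powerMass_empty]⟩
  | succ N ih =>
    obtain ⟨δ, hδ, ih⟩ := ih
    refine ⟨min t (((ε * t) ^ (k + 1) * δ) ^ (k + 1)), by positivity, ?_⟩
    intro P _ _ x0 hbot μ hμ hsum hx0 n m A hA hAε J hJ
    classical
    obtain ⟨I, hIJ, hIt, hI⟩ := exists_subset_powerMass_forall_notMem hbot hμ hsum hx0 hk hA
      hAε hε.le ht.le ht1 J (hJ.trans (min_le_left _ _))
    have hrest : powerMass μ n {ω | ∀ i ∈ J \ I, ω ∉ A i} ≤ δ := by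
      have hc := powerMass_mul_pow_le_inter hbot hμ hsum hx0 hk n
        (isLowerSet_forall_notMem hA I) (isLowerSet_forall_notMem hA (J \ I))
      have hset : {ω | ∀ i ∈ I, ω ∉ A i} ∩ {ω | ∀ i ∈ J \ I, ω ∉ A i}
          = {ω | ∀ i ∈ J, ω ∉ A i} := by
        ext ω
        refine ⟨fun h i hi => ?_, fun h =>
          ⟨fun i hi => h i (hIJ hi), fun i hi => h i (Finset.mem_sdiff.1 hi).1⟩⟩
        by_cases hiI : i ∈ I
        · exact h.1 i hiI
        · exact h.2 i (Finset.mem_sdiff.2 ⟨hi, hiI⟩)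
      rw [hset] at hc
      have h1 := le_of_pow_le_pow_left₀ (Nat.succ_ne_zero k) (by positivity)
        (hc.trans (hJ.trans (min_le_right _ _)))
      have h2 := mul_le_mul_of_nonneg_right hI
        (powerMass_nonneg hμ {ω | ∀ i ∈ J \ I, ω ∉ A i})
      exact le_of_mul_le_mul_left (h2.trans h1) (by positivity)
    have hN := ih P x0 hbot μ hμ hsum hx0 n m A hA hAε (J \ I) hrest
    have hsub : {ω | Set.ncard {i | i ∈ J ∧ ω ∈ A i} < N + 1}
        ⊆ {ω | ∀ i ∈ I, ω ∉ A i} ∪ {ω | Set.ncard {i | i ∈ J \ I ∧ ω ∈ A i} < N} := by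
      intro ω hω
      by_contra hcon
      simp only [Set.mem_union, Set.mem_ofPred_eq, not_or, not_forall, not_not, not_lt] at hcon hω
      obtain ⟨⟨i, hi, hiA⟩, hcard⟩ := hcon
      have hnot : i ∉ {i | i ∈ J \ I ∧ ω ∈ A i} := fun h => (Finset.mem_sdiff.1 h.1).2 hi
      have hins : insert i {i | i ∈ J \ I ∧ ω ∈ A i} ⊆ {i | i ∈ J ∧ ω ∈ A i} := by
        rintro j (rfl | hj)
        · exact ⟨hIJ hi, hiA⟩
        · exact ⟨(Finset.mem_sdiff.1 hj.1).1, hj.2⟩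
      have hle := Set.ncard_le_ncard hins (Set.toFinite _)
      rw [Set.ncard_insert_of_notMem hnot (Set.toFinite _)] at hle
      omega
    refine (powerMass_mono hμ hsub).trans ((powerMass_union_le hμ _ _).trans ?_)
    push_cast
    linarith


/-- **Many upsets hold simultaneously** (Lemma 3.4).
For every `p₀ ∈ (0,1]`, positive integer `N` and `ε > 0` there is `δ > 0` such
that the following holds for every finite poset `P` with a least element of
probability at least `p₀`: if `A₁, …, A_m` are upsets in `P^n`, each of measure
at most `1 - ε`, whose union has measure at least `1 - δ`, then with probability
at least `1 - ε` at least `N` of the events `A_i` hold. -/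
theorem many_upsets_hold (p0 : ℝ) (hp0 : 0 < p0) (hp0' : p0 ≤ 1)
    (N : ℕ) (hN : 0 < N) (ε : ℝ) (hε : 0 < ε) :
    ∃ δ : ℝ, 0 < δ ∧
      ∀ (P : Type) [Fintype P] [PartialOrder P] (x0 : P), (∀ x : P, x0 ≤ x) →
      ∀ μ : P → ℝ, (∀ x, 0 ≤ μ x) → (∑ x : P, μ x = 1) → p0 ≤ μ x0 →
      ∀ (n m : ℕ), 1 ≤ n → 1 ≤ m →
      ∀ A : Fin m → Set (Fin n → P),
        (∀ i, IsUpperSet (A i)) →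
        (∀ i, (∑ x : Fin n → P, (A i).indicator (fun y => ∏ j, μ (y j)) x) ≤ 1 - ε) →
        (∑ x : Fin n → P, (⋃ i, A i).indicator (fun y => ∏ j, μ (y j)) x) ≥ 1 - δ →
        (∑ x : Fin n → P,
            Set.indicator {ω : Fin n → P | N ≤ Set.ncard {i : Fin m | ω ∈ A i}}
              (fun y => ∏ j, μ (y j)) x) ≥ 1 - ε := by
  rcases le_or_gt 1 ε with hε1 | hε1
  · refine ⟨1, one_pos, ?_⟩
    intro P _ _ x0 _ μ hμ _ _ n m _ _ A _ _ _
    have h := powerMass_nonneg hμ {ω : Fin n → P | N ≤ Set.ncard {i : Fin m | ω ∈ A i}}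
    unfold powerMass at h
    linarith
  obtain ⟨k, hk⟩ := exists_nat_ge (1 / p0)
  have hk' : 1 ≤ p0 * (k + 1) := by
    rw [div_le_iff₀ hp0] at hk
    linarith
  have hN1 : (1 : ℝ) ≤ N := by exact_mod_cast hN
  have hN0 : (0 : ℝ) < N := by linarith
  obtain ⟨δ, hδ, h⟩ := exists_forall_powerMass_card_lt_le hk' hε (t := ε / N) (by positivity)
    (by rw [div_lt_one hN0]; linarith) N
  refine ⟨δ, hδ, ?_⟩
  intro P _ _ x0 hbot μ hμ hsum hx0 n m _ _ A hA hAε hU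
  have hnone : powerMass μ n {ω | ∀ i ∈ Finset.univ, ω ∉ A i} ≤ δ := by
    have hset : {ω | ∀ i ∈ Finset.univ, ω ∉ A i} = (⋃ i, A i)ᶜ := by ext ω; simp
    rw [hset, powerMass_compl hsum]
    unfold powerMass
    linarith
  have hfew := h P x0 hbot μ hμ hsum hx0 n m A hA hAε Finset.univ hnone
  have hset : {ω : Fin n → P | N ≤ Set.ncard {i : Fin m | ω ∈ A i}}
      = {ω | Set.ncard {i | i ∈ Finset.univ ∧ ω ∈ A i} < N}ᶜ := by
    ext ω; simp
  have hgoal := powerMass_compl (n := n) hsum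
    {ω | Set.ncard {i | i ∈ Finset.univ ∧ ω ∈ A i} < N}
  rw [← hset] at hgoal
  rw [mul_div_cancel₀ _ hN0.ne'] at hfew
  change powerMass μ n {ω : Fin n → P | N ≤ Set.ncard {i : Fin m | ω ∈ A i}} ≥ 1 - ε
  linarith
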